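/- Let ℓ₀ be the smallest integer ℓ ≥ 1 such that h_{Ā₁…Ā_ℓ D}(0) ≠ 0 for some indices A₁, …, A_ℓ, D ∈ {1,…,n} (so h_{Ā₁…Ā_r D}(0) = 0 for all indices whenever r < ℓ₀), with ℓ₀ = ∞ if no such ℓ exists. Then for all integers r ≥ 2 and j ≥ 0 with j + r ≤ ℓ₀ and all indices A₁, …, A_r, C₁, …, C_j, D ∈ {1,…,n}: (L_C̄₁ ⋯ L_C̄_j h_{Ā₁…Ā_{r−1} Ā_r D})(0) = (L_C̄₁ ⋯ L_C̄_j L_Ā_r h_{Ā₁…Ā_{r−1} D})(0). In particular, if ℓ₀ < ∞ then h_{Ā₁ Ā₂ … Ā_{ℓ₀} D}(0) = (L_Ā_{ℓ₀} ⋯ L_Ā₂ h_{Ā₁ D})(0). -/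

import Mathlib

open scoped Topology

noncomputable section

/-- A complex vector field on (an open subset of) `ℝ^m`, given by its components:
it acts on functions by `(Xu)(x) = Du(x)·X(x)`. -/
abbrev VF (m : ℕ) := (Fin m → ℝ) → Fin m → ℂ

/-- A complex 1-form on `ℝ^m`, given by its components in the standard coordinates. -/
abbrev Form (m : ℕ) := (Fin m → ℝ) → Fin m → ℂ

/-- The action `(Xu)(x) = Du(x)·X(x)` of a complex vector field on a function. -/
noncomputable def vapp {m : ℕ} (X : VF m) (u : (Fin m → ℝ) → ℂ) (x : Fin m → ℝ) : ℂ :=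
  ∑ i, X x i * fderiv ℝ u x (Pi.single i 1)

/-- The Lie bracket `[X,Y](x) = DY(x)·X(x) − DX(x)·Y(x)` of complex vector fields. -/
noncomputable def vbrk {m : ℕ} (X Y : VF m) : VF m :=
  fun x j => vapp X (fun y => Y y j) x - vapp Y (fun y => X y j) x

/-- The componentwise complex conjugate `X̄` of a complex vector field. -/
def vconj {m : ℕ} (X : VF m) : VF m := fun x i => (starRingEnd ℂ) (X x i)

/-- The pairing `⟨ω,X⟩(x) = ω(x)(X(x))` of a 1-form with a vector field. -/
noncomputable def fpair {m : ℕ} (ω : Form m) (X : VF m) : (Fin m → ℝ) → ℂ :=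
  fun x => ∑ i, ω x i * X x i

/-- `⟨dω, X∧Y⟩ = X⟨ω,Y⟩ − Y⟨ω,X⟩ − ⟨ω,[X,Y]⟩`. -/
noncomputable def dpair {m : ℕ} (ω : Form m) (X Y : VF m) (x : Fin m → ℝ) : ℂ :=
  vapp X (fpair ω Y) x - vapp Y (fpair ω X) x - fpair ω (vbrk X Y) x

/-- The Lie derivative `ℒ_X ω := X ⌟ dω`, in components: its pairing with a constant
coordinate vector field is `⟨dω, X ∧ e_i⟩`. -/
noncomputable def lieD {m : ℕ} (X : VF m) (ω : Form m) : Form m :=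
  fun x i => dpair ω X (fun _ => Pi.single i 1) x

/-- Iterated Lie derivative `ℒ_{X_k} ⋯ ℒ_{X_1} ω`, for `Xs = [X₁,…,X_k]`. -/
noncomputable def iterLieD {m : ℕ} (Xs : List (VF m)) (ω : Form m) : Form m :=
  Xs.foldl (fun w X => lieD X w) ω

/-- `h_{Ā₁…Ā_k B} := ⟨ℒ_{L_{Ā_k}} ⋯ ℒ_{L_{Ā₁}} θ, L_B⟩` (for `As = [A₁,…,A_k]`). -/
noncomputable def hD {n : ℕ} (L : Fin n → VF (2 * n + 1)) (θ : Form (2 * n + 1))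
    (As : List (Fin n)) (B : Fin n) : (Fin (2 * n + 1) → ℝ) → ℂ :=
  fpair (iterLieD (As.map fun A => vconj (L A)) θ) (L B)

/-- `h_{Ā₁…Ā_k} := ⟨ℒ_{L_{Ā_k}} ⋯ ℒ_{L_{Ā₁}} θ, T⟩`. -/
noncomputable def hT {n : ℕ} (L : Fin n → VF (2 * n + 1)) (T : VF (2 * n + 1))
    (θ : Form (2 * n + 1)) (As : List (Fin n)) : (Fin (2 * n + 1) → ℝ) → ℂ :=
  fpair (iterLieD (As.map fun A => vconj (L A)) θ) T

/-- The frame and dual coframe data of Context 5/6/7/18: `T, L_A, L_Ā` is a smooth pointwise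
basis of `ℂ^{2n+1}` on `Ω`, the span of the `L_Ā` is closed under brackets (integrable CR
structure of hypersurface type), and `θ, θ^A, θ^Ā` is the dual coframe. -/
structure CRFrame (n : ℕ) (Ω : Set (Fin (2 * n + 1) → ℝ)) (T : VF (2 * n + 1))
    (L : Fin n → VF (2 * n + 1)) (θ : Form (2 * n + 1))
    (θup θbar : Fin n → Form (2 * n + 1)) : Prop where
  open_Ω : IsOpen Ω
  mem0 : (0 : Fin (2 * n + 1) → ℝ) ∈ Ω
  smoothT : ContDiffOn ℝ (⊤ : ℕ∞) T Ω
  smoothL : ∀ A, ContDiffOn ℝ (⊤ : ℕ∞) (L A) Ω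
  smoothθ : ContDiffOn ℝ (⊤ : ℕ∞) θ Ω
  smoothθup : ∀ A, ContDiffOn ℝ (⊤ : ℕ∞) (θup A) Ω
  smoothθbar : ∀ A, ContDiffOn ℝ (⊤ : ℕ∞) (θbar A) Ω
  indep : ∀ x ∈ Ω, LinearIndependent ℂ
    (Sum.elim (fun _ : Fin 1 => T x) (Sum.elim (fun A => L A x) (fun A => vconj (L A) x)))
  spans : ∀ x ∈ Ω, Submodule.span ℂ
    (Set.range (Sum.elim (fun _ : Fin 1 => T x)
      (Sum.elim (fun A => L A x) (fun A => vconj (L A) x)))) = ⊤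
  integrable : ∀ A B, ∀ x ∈ Ω, vbrk (vconj (L A)) (vconj (L B)) x ∈
    Submodule.span ℂ (Set.range fun C => vconj (L C) x)
  dual_θ_T : ∀ x ∈ Ω, fpair θ T x = 1
  dual_θ_L : ∀ A, ∀ x ∈ Ω, fpair θ (L A) x = 0
  dual_θ_Lb : ∀ A, ∀ x ∈ Ω, fpair θ (vconj (L A)) x = 0
  dual_θup_T : ∀ A, ∀ x ∈ Ω, fpair (θup A) T x = 0
  dual_θup_L : ∀ A B, ∀ x ∈ Ω, fpair (θup A) (L B) x = if A = B then 1 else 0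
  dual_θup_Lb : ∀ A B, ∀ x ∈ Ω, fpair (θup A) (vconj (L B)) x = 0
  dual_θbar_T : ∀ A, ∀ x ∈ Ω, fpair (θbar A) T x = 0
  dual_θbar_L : ∀ A B, ∀ x ∈ Ω, fpair (θbar A) (L B) x = 0
  dual_θbar_Lb : ∀ A B, ∀ x ∈ Ω, fpair (θbar A) (vconj (L B)) x = if A = B then 1 else 0

/-- Iterated application `L_C̄₁ ⋯ L_C̄_j u` of the conjugated frame fields (for
`Cs = [C₁,…,C_j]`, with `C̄₁` outermost). -/
noncomputable def iterApp {n : ℕ} (L : Fin n → VF (2 * n + 1)) (Cs : List (Fin n))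
    (u : (Fin (2 * n + 1) → ℝ) → ℂ) : (Fin (2 * n + 1) → ℝ) → ℂ :=
  Cs.foldr (fun C v => vapp (vconj (L C)) v) u

section helpers
variable {m : ℕ} {Ω : Set (Fin m → ℝ)}

abbrev Sm {E : Type*} [NormedAddCommGroup E] [NormedSpace ℝ E] (Ω : Set (Fin m → ℝ))
    (u : (Fin m → ℝ) → E) : Prop := ContDiffOn ℝ (⊤ : ℕ∞) u Ω

lemma Sm.diff {E : Type*} [NormedAddCommGroup E] [NormedSpace ℝ E] (hΩ : IsOpen Ω)
    {u : (Fin m → ℝ) → E} (hu : Sm Ω u) {x} (hx : x ∈ Ω) : DifferentiableAt ℝ u x :=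
  (hu.contDiffAt (hΩ.mem_nhds hx)).differentiableAt (by simp)

lemma Sm.comp_i {X : VF m} (hX : Sm Ω X) (i : Fin m) : Sm Ω (fun x => X x i) :=
  contDiffOn_pi.1 hX i

lemma Sm.vapp (hΩ : IsOpen Ω) {X : VF m} {u : (Fin m → ℝ) → ℂ} (hX : Sm Ω X) (hu : Sm Ω u) :
    Sm Ω (vapp X u) := by
  unfold _root_.vapp
  refine ContDiffOn.sum fun i _ => (hX.comp_i i).mul ?_
  have h : ContDiffOn ℝ (⊤ : ℕ∞) (fderiv ℝ u) Ω := hu.fderiv_of_isOpen hΩ (by simp)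
  exact h.clm_apply contDiffOn_const

lemma Sm.vbrk (hΩ : IsOpen Ω) {X Y : VF m} (hX : Sm Ω X) (hY : Sm Ω Y) :
    Sm Ω (vbrk X Y) :=
  contDiffOn_pi.2 fun i => (Sm.vapp hΩ hX (hY.comp_i i)).sub (Sm.vapp hΩ hY (hX.comp_i i))

lemma Sm.vconj {X : VF m} (hX : Sm Ω X) : Sm Ω (vconj X) :=
  contDiffOn_pi.2 fun i => Complex.conjCLE.contDiff.comp_contDiffOn (hX.comp_i i)

lemma Sm.fpair {ω : Form m} {X : VF m} (hω : Sm Ω ω) (hX : Sm Ω X) : Sm Ω (fpair ω X) := by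
  unfold _root_.fpair
  exact ContDiffOn.sum fun i _ => (hω.comp_i i).mul (hX.comp_i i)

lemma Sm.lieD (hΩ : IsOpen Ω) {ω : Form m} {X : VF m} (hω : Sm Ω ω) (hX : Sm Ω X) :
    Sm Ω (lieD X ω) := by
  refine contDiffOn_pi.2 fun i => ?_
  have hc : Sm Ω (fun _ : Fin m → ℝ => (Pi.single i 1 : Fin m → ℂ)) := contDiffOn_const
  exact ((Sm.vapp hΩ hX (hω.fpair hc)).sub (Sm.vapp hΩ hc (hω.fpair hX))).sub
    (hω.fpair (Sm.vbrk hΩ hX hc))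

lemma vapp_congr (hΩ : IsOpen Ω) (X : VF m) {u v : (Fin m → ℝ) → ℂ} (h : Set.EqOn u v Ω) :
    Set.EqOn (vapp X u) (vapp X v) Ω := by
  intro x hx
  have : u =ᶠ[𝓝 x] v := Filter.eventuallyEq_of_mem (hΩ.mem_nhds hx) h
  simp only [vapp, this.fderiv_eq]

lemma vapp_zero (X : VF m) (x) : vapp X (fun _ => 0) x = 0 := by
  simp [vapp]

lemma vapp_add (X : VF m) {u v : (Fin m → ℝ) → ℂ} {x} (hu : DifferentiableAt ℝ u x)
    (hv : DifferentiableAt ℝ v x) :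
    vapp X (fun y => u y + v y) x = vapp X u x + vapp X v x := by
  simp only [vapp, fderiv_fun_add hu hv, ← Finset.sum_add_distrib, ContinuousLinearMap.add_apply,
    mul_add]

lemma vapp_mul (X : VF m) {u v : (Fin m → ℝ) → ℂ} {x} (hu : DifferentiableAt ℝ u x)
    (hv : DifferentiableAt ℝ v x) :
    vapp X (fun y => u y * v y) x = u x * vapp X v x + vapp X u x * v x := by
  simp only [vapp, fderiv_fun_mul hu hv, Finset.mul_sum, Finset.sum_mul,
    ← Finset.sum_add_distrib]
  refine Finset.sum_congr rfl fun i _ => ?_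
  simp
  ring

lemma vapp_fpair (hΩ : IsOpen Ω) (X : VF m) {ω : Form m} {Y : VF m} (hω : Sm Ω ω)
    (hY : Sm Ω Y) {x} (hx : x ∈ Ω) :
    vapp X (fpair ω Y) x = ∑ i, (ω x i * vapp X (fun y => Y y i) x
      + vapp X (fun y => ω y i) x * Y x i) := by
  have h1 : vapp X (fpair ω Y) x = ∑ i, vapp X (fun y => ω y i * Y y i) x := by
    unfold fpair
    simp only [vapp]
    rw [fderiv_fun_sum (A := fun i y => ω y i * Y y i)
      fun i _ => ((hω.comp_i i).diff hΩ hx).mul ((hY.comp_i i).diff hΩ hx)]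
    rw [Finset.sum_comm]
    simp [Finset.mul_sum]
  rw [h1]
  exact Finset.sum_congr rfl fun i _ =>
    vapp_mul X ((hω.comp_i i).diff hΩ hx) ((hY.comp_i i).diff hΩ hx)

lemma dpair_eq (hΩ : IsOpen Ω) {ω : Form m} {X Y : VF m} (hω : Sm Ω ω) (hX : Sm Ω X)
    (hY : Sm Ω Y) {x} (hx : x ∈ Ω) :
    dpair ω X Y x = ∑ i, (vapp X (fun y => ω y i) x * Y x i
      - vapp Y (fun y => ω y i) x * X x i) := by
  rw [dpair, vapp_fpair hΩ X hω hY hx, vapp_fpair hΩ Y hω hX hx]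
  simp only [fpair, vbrk, ← Finset.sum_sub_distrib]
  exact Finset.sum_congr rfl fun i _ => by ring

lemma fpair_lieD (hΩ : IsOpen Ω) {ω : Form m} {X Y : VF m} (hω : Sm Ω ω) (hX : Sm Ω X)
    (hY : Sm Ω Y) {x} (hx : x ∈ Ω) :
    fpair (lieD X ω) Y x = dpair ω X Y x := by
  rw [dpair_eq hΩ hω hX hY hx]
  have h : ∀ i, lieD X ω x i = vapp X (fun y => ω y i) x
      - ∑ k, fderiv ℝ (fun y => ω y k) x (Pi.single i 1) * X x k := by
    intro i
    rw [lieD, dpair_eq hΩ hω hX contDiffOn_const hx, Finset.sum_sub_distrib]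
    simp [vapp, Pi.single_apply]
  simp only [fpair, h, sub_mul, Finset.sum_sub_distrib]
  congr 1
  simp only [vapp, Finset.sum_mul]
  rw [Finset.sum_comm]
  exact Finset.sum_congr rfl fun i _ => Finset.sum_congr rfl fun k _ => by ring

/-- pairing at a point as a linear map -/
def plin (w : Fin m → ℂ) : (Fin m → ℂ) →ₗ[ℂ] ℂ := Fintype.linearCombination ℂ w

lemma plin_apply (ω : Form m) (X : VF m) (x) : plin (ω x) (X x) = fpair ω X x := by
  simp [plin, Fintype.linearCombination_apply, fpair, mul_comm]

end helpers

section frame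
variable {n : ℕ} {Ω : Set (Fin (2 * n + 1) → ℝ)} {T : VF (2 * n + 1)}
  {L : Fin n → VF (2 * n + 1)} {θ : Form (2 * n + 1)} {θup θbar : Fin n → Form (2 * n + 1)}

/-- iterated form -/
abbrev om (L : Fin n → VF (2 * n + 1)) (θ : Form (2 * n + 1)) (As : List (Fin n)) :=
  iterLieD (As.map fun A => vconj (L A)) θ

lemma om_snoc (As : List (Fin n)) (A : Fin n) :
    om L θ (As ++ [A]) = lieD (vconj (L A)) (om L θ As) := by
  simp [om, iterLieD]

lemma om_smooth (h : CRFrame n Ω T L θ θup θbar) (As : List (Fin n)) : Sm Ω (om L θ As) := by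
  induction As using List.reverseRecOn with
  | nil => simpa [om, iterLieD] using h.smoothθ
  | append_singleton As A ih =>
    rw [om_snoc]; exact Sm.lieD h.open_Ω ih (Sm.vconj (h.smoothL A))

lemma hD_smooth (h : CRFrame n Ω T L θ θup θbar) (As : List (Fin n)) (D : Fin n) :
    Sm Ω (hD L θ As D) := Sm.fpair (om_smooth h As) (h.smoothL D)

lemma om_Lb (h : CRFrame n Ω T L θ θup θbar) (As : List (Fin n)) (C : Fin n) :
    Set.EqOn (fpair (om L θ As) (vconj (L C))) (fun _ => 0) Ω := by
  induction As using List.reverseRecOn generalizing C with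
  | nil => intro x hx; simpa [om, iterLieD] using h.dual_θ_Lb C x hx
  | append_singleton As A ih =>
    intro x hx
    rw [om_snoc, fpair_lieD h.open_Ω (om_smooth h As) (Sm.vconj (h.smoothL A))
      (Sm.vconj (h.smoothL C)) hx, dpair, vapp_congr h.open_Ω _ (ih C) hx,
      vapp_congr h.open_Ω _ (ih A) hx, vapp_zero, vapp_zero]
    have h0 : Submodule.span ℂ (Set.range fun C => vconj (L C) x) ≤
        LinearMap.ker (plin (om L θ As x)) := by
      rw [Submodule.span_le]
      rintro _ ⟨C, rfl⟩
      simpa [plin_apply] using ih C hx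
    have := h0 (h.integrable A C x hx)
    rw [LinearMap.mem_ker, plin_apply] at this
    simp [this]

lemma decomp (h : CRFrame n Ω T L θ θup θbar) {ω : Form (2 * n + 1)}
    (hω : ∀ C, ∀ x ∈ Ω, fpair ω (vconj (L C)) x = 0) (Z : VF (2 * n + 1)) {x} (hx : x ∈ Ω) :
    fpair ω Z x = fpair θ Z x * fpair ω T x + ∑ B, fpair (θup B) Z x * fpair ω (L B) x := by
  have key : plin (ω x) = (fpair ω T x) • plin (θ x) +
      ∑ B, (fpair ω (L B) x) • plin (θup B x) := by
    refine LinearMap.ext_on (h.spans x hx) ?_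
    rintro _ ⟨(_ | B | B), rfl⟩
    · simp [plin_apply, LinearMap.sum_apply, h.dual_θ_T x hx, h.dual_θup_T _ x hx]
    · simp [plin_apply, LinearMap.sum_apply, h.dual_θ_L _ x hx, h.dual_θup_L _ _ x hx]
    · simp [plin_apply, LinearMap.sum_apply, h.dual_θ_Lb _ x hx, h.dual_θup_Lb _ _ x hx,
        hω B x hx]
  rw [← plin_apply, key]
  simp [plin_apply, LinearMap.sum_apply, mul_comm]

/-- the error term -/
def err (L : Fin n → VF (2 * n + 1)) (T : VF (2 * n + 1)) (θ : Form (2 * n + 1))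
    (θup : Fin n → Form (2 * n + 1)) (As : List (Fin n)) (A D : Fin n) :
    (Fin (2 * n + 1) → ℝ) → ℂ := fun x =>
  hT L T θ As x * hD L θ [A] D x
    + ∑ B, -fpair (θup B) (vbrk (vconj (L A)) (L D)) x * hD L θ As B x

lemma hD_snoc (h : CRFrame n Ω T L θ θup θbar) (As : List (Fin n)) (A D : Fin n) {x}
    (hx : x ∈ Ω) : hD L θ (As ++ [A]) D x = vapp (vconj (L A)) (hD L θ As D) x
      - fpair (om L θ As) (vbrk (vconj (L A)) (L D)) x := by
  change fpair (om L θ (As ++ [A])) (L D) x = _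
  rw [om_snoc, fpair_lieD h.open_Ω (om_smooth h As) (Sm.vconj (h.smoothL A)) (h.smoothL D) hx,
    dpair, vapp_congr h.open_Ω _ (om_Lb h As A) hx, vapp_zero, sub_zero]
  rfl

lemma hD_one (h : CRFrame n Ω T L θ θup θbar) (A D : Fin n) {x}
    (hx : x ∈ Ω) : hD L θ [A] D x = - fpair θ (vbrk (vconj (L A)) (L D)) x := by
  have := hD_snoc h [] A D hx
  have h0 : Set.EqOn (hD L θ [] D) (fun _ => 0) Ω := fun y hy => h.dual_θ_L D y hy
  rw [vapp_congr h.open_Ω _ h0 hx, vapp_zero, zero_sub] at this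
  exact this

lemma hD_err (h : CRFrame n Ω T L θ θup θbar) (As : List (Fin n)) (A D : Fin n) :
    Set.EqOn (hD L θ (As ++ [A]) D)
      (fun x => vapp (vconj (L A)) (hD L θ As D) x + err L T θ θup As A D x) Ω := by
  intro x hx
  rw [hD_snoc h As A D hx, decomp h (fun C x hx => om_Lb h As C hx) _ hx]
  simp only [err, hD_one h A D hx, neg_mul, Finset.sum_neg_distrib]
  simp only [hD, hT]
  ring

lemma iterApp_snoc (Cs : List (Fin n)) (C : Fin n) (u : (Fin (2 * n + 1) → ℝ) → ℂ) :
    iterApp L (Cs ++ [C]) u = iterApp L Cs (vapp (vconj (L C)) u) := by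
  simp [iterApp]

lemma iterApp_congr (hΩ : IsOpen Ω) (Cs : List (Fin n)) {u v : (Fin (2 * n + 1) → ℝ) → ℂ}
    (huv : Set.EqOn u v Ω) : Set.EqOn (iterApp L Cs u) (iterApp L Cs v) Ω := by
  induction Cs with
  | nil => exact huv
  | cons C Cs ih => exact vapp_congr hΩ _ ih

lemma iterApp_smooth (h : CRFrame n Ω T L θ θup θbar) (Cs : List (Fin n))
    {u : (Fin (2 * n + 1) → ℝ) → ℂ} (hu : Sm Ω u) : Sm Ω (iterApp L Cs u) := by
  induction Cs with
  | nil => exact hu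
  | cons C Cs ih => exact Sm.vapp h.open_Ω (Sm.vconj (h.smoothL C)) ih

lemma iterApp_add (h : CRFrame n Ω T L θ θup θbar) (Cs : List (Fin n))
    {u v : (Fin (2 * n + 1) → ℝ) → ℂ} (hu : Sm Ω u) (hv : Sm Ω v) :
    Set.EqOn (iterApp L Cs (fun x => u x + v x))
      (fun x => iterApp L Cs u x + iterApp L Cs v x) Ω := by
  induction Cs with
  | nil => intro x _; rfl
  | cons C Cs ih =>
    intro x hx
    exact (vapp_congr h.open_Ω _ ih hx).trans (vapp_add _
      ((iterApp_smooth h Cs hu).diff h.open_Ω hx) ((iterApp_smooth h Cs hv).diff h.open_Ω hx))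

lemma iterApp_add0 (h : CRFrame n Ω T L θ θup θbar) (Cs : List (Fin n))
    {u v : (Fin (2 * n + 1) → ℝ) → ℂ} (hu : Sm Ω u) (hv : Sm Ω v) :
    iterApp L Cs (fun x => u x + v x) 0 = iterApp L Cs u 0 + iterApp L Cs v 0 :=
  iterApp_add h Cs hu hv h.mem0

/-- vanishing to order `k` along the conjugate fields -/
def Van (L : Fin n → VF (2 * n + 1)) (k : ℕ) (u : (Fin (2 * n + 1) → ℝ) → ℂ) : Prop :=
  ∀ Cs : List (Fin n), Cs.length ≤ k → iterApp L Cs u 0 = 0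

lemma Van.mono {k l : ℕ} {u : (Fin (2 * n + 1) → ℝ) → ℂ} (hu : Van L k u) (hl : l ≤ k) :
    Van L l u := fun Cs hC => hu Cs (hC.trans hl)

lemma Van.congr (h : CRFrame n Ω T L θ θup θbar) {k : ℕ} {u v : (Fin (2 * n + 1) → ℝ) → ℂ}
    (huv : Set.EqOn u v Ω) (hv : Van L k v) : Van L k u := fun Cs hC =>
  (iterApp_congr h.open_Ω Cs huv h.mem0).trans (hv Cs hC)

lemma Van.add (h : CRFrame n Ω T L θ θup θbar) {k : ℕ} {u v : (Fin (2 * n + 1) → ℝ) → ℂ}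
    (su : Sm Ω u) (sv : Sm Ω v) (hu : Van L k u) (hv : Van L k v) :
    Van L k (fun x => u x + v x) := fun Cs hC => by
  rw [iterApp_add0 h Cs su sv, hu Cs hC, hv Cs hC, add_zero]

lemma Van.zero (h : CRFrame n Ω T L θ θup θbar) (k : ℕ) : Van L k (fun _ => 0) := by
  have : ∀ Cs : List (Fin n), iterApp L Cs (fun _ => 0) = fun _ => 0 := by
    intro Cs
    induction Cs with
    | nil => rfl
    | cons C Cs ih =>
      change vapp _ (iterApp L Cs _) = _
      rw [ih]; funext x; exact vapp_zero _ x
  intro Cs _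
  rw [this]

lemma Van.sum (h : CRFrame n Ω T L θ θup θbar) {k : ℕ}
    {u : Fin n → (Fin (2 * n + 1) → ℝ) → ℂ} (su : ∀ i, Sm Ω (u i)) (hu : ∀ i, Van L k (u i)) :
    Van L k (fun x => ∑ i, u i x) := by
  have : ∀ s : Finset (Fin n), Van L k (fun x => ∑ i ∈ s, u i x) := by
    intro s
    induction s using Finset.induction_on with
    | empty => simpa using Van.zero h k
    | insert a s ha ih =>
      simp only [Finset.sum_insert ha]
      exact Van.add h (su a) (ContDiffOn.sum fun i _ => su i) (hu a) ih
  exact this _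

lemma Van.mul (h : CRFrame n Ω T L θ θup θbar) {k : ℕ} {f u : (Fin (2 * n + 1) → ℝ) → ℂ}
    (sf : Sm Ω f) (su : Sm Ω u) (hu : Van L k u) : Van L k (fun x => f x * u x) := by
  induction k generalizing f u with
  | zero =>
    intro Cs hC
    have : Cs = [] := List.length_eq_zero_iff.1 (by omega)
    subst this
    have := hu [] (by simp)
    simp only [iterApp, List.foldr_nil] at this ⊢
    simp [this]
  | succ k ih =>
    intro Cs hC
    rcases List.eq_nil_or_concat Cs with rfl | ⟨Cs, C, rfl⟩
    · have := hu [] (by simp)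
      simp only [iterApp, List.foldr_nil] at this ⊢
      simp [this]
    · have sC := Sm.vconj (h.smoothL C)
      have s1 := Sm.vapp h.open_Ω sC su
      have s2 := Sm.vapp h.open_Ω sC sf
      rw [List.concat_eq_append, iterApp_snoc]
      simp only [List.concat_eq_append, List.length_append, List.length_singleton] at hC
      refine Van.congr h (k := k) (v := fun x => f x * vapp (vconj (L C)) u x +
        vapp (vconj (L C)) f x * u x) ?_ ?_ Cs (by omega)
      · intro x hx
        exact vapp_mul _ (sf.diff h.open_Ω hx) (su.diff h.open_Ω hx)
      · refine Van.add h (sf.mul s1) (s2.mul su) (ih sf s1 ?_) (ih s2 su (hu.mono (by omega)))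
        intro Ds hD
        rw [← iterApp_snoc]
        exact hu _ (by simp; omega)

lemma hT_smooth (h : CRFrame n Ω T L θ θup θbar) (As : List (Fin n)) :
    Sm Ω (hT L T θ As) := Sm.fpair (om_smooth h As) h.smoothT

lemma br_smooth (h : CRFrame n Ω T L θ θup θbar) (A D B : Fin n) :
    Sm Ω (fun x => -fpair (θup B) (vbrk (vconj (L A)) (L D)) x) :=
  (Sm.fpair (h.smoothθup B) (Sm.vbrk h.open_Ω (Sm.vconj (h.smoothL A)) (h.smoothL D))).neg

lemma err_smooth (h : CRFrame n Ω T L θ θup θbar) (As : List (Fin n)) (A D : Fin n) :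
    Sm Ω (err L T θ θup As A D) :=
  ((hT_smooth h As).mul (hD_smooth h [A] D)).add
    (ContDiffOn.sum fun B _ => (br_smooth h A D B).mul (hD_smooth h As B))

lemma err_van (h : CRFrame n Ω T L θ θup θbar) (As : List (Fin n)) (A D : Fin n) {k : ℕ}
    (h1 : Van L k (hD L θ [A] D)) (h2 : ∀ B, Van L k (hD L θ As B)) :
    Van L k (err L T θ θup As A D) :=
  Van.add h ((hT_smooth h As).mul (hD_smooth h [A] D))
    (ContDiffOn.sum fun B _ => (br_smooth h A D B).mul (hD_smooth h As B))
    (Van.mul h (hT_smooth h As) (hD_smooth h [A] D) h1)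
    (Van.sum h (fun B => (br_smooth h A D B).mul (hD_smooth h As B))
      fun B => Van.mul h (br_smooth h A D B) (hD_smooth h As B) (h2 B))

lemma hD_van (h : CRFrame n Ω T L θ θup θbar) {ℓ₀ : ℕ∞}
    (hvan : ∀ (As : List (Fin n)) (D : Fin n), 1 ≤ As.length →
      (As.length : ℕ∞) < ℓ₀ → hD L θ As D 0 = 0) (k : ℕ) :
    ∀ (As : List (Fin n)) (D : Fin n), 1 ≤ As.length →
      ((k + As.length : ℕ) : ℕ∞) < ℓ₀ → Van L k (hD L θ As D) := by
  induction k with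
  | zero =>
    intro As D h1 h2 Cs hC
    have : Cs = [] := List.length_eq_zero_iff.1 (by omega)
    subst this
    exact hvan As D h1 (by simpa using h2)
  | succ k ih =>
    intro As D h1 h2 Cs hC
    have lt : ∀ j : ℕ, j ≤ k + 1 + As.length → (j : ℕ∞) < ℓ₀ := fun j hj =>
      lt_of_le_of_lt (by exact_mod_cast hj) h2
    rcases List.eq_nil_or_concat Cs with rfl | ⟨Cs, C, rfl⟩
    · exact hvan As D h1 (lt _ (by omega))
    · rw [List.concat_eq_append, iterApp_snoc]
      simp only [List.concat_eq_append, List.length_append, List.length_singleton] at hC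
      have e := iterApp_congr (L := L) h.open_Ω Cs (hD_err h As C D) h.mem0
      rw [iterApp_add0 h Cs (Sm.vapp h.open_Ω (Sm.vconj (h.smoothL C)) (hD_smooth h As D))
        (err_smooth h As C D),
        ih (As ++ [C]) D (by simp) (lt _ (by simp; omega)) Cs (by omega),
        err_van h As C D (ih [C] D (by simp) (lt _ (by simp)))
          (fun B => ih As B h1 (lt _ (by omega))) Cs (by omega), add_zero] at e
      exact e.symm

end frame

/-- Let `ℓ₀ ∈ ℕ∞` be the smallest integer `ℓ ≥ 1` such that
`h_{Ā₁…Ā_ℓ D}(0) ≠ 0` for some indices (`⊤` if none exists); the hypotheses `hvan`, `hex`,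
`hpos` say exactly that `ℓ₀` is this smallest value.  Then for all `r ≥ 2`, `j ≥ 0` with
`j + r ≤ ℓ₀` and all indices,
`(L_C̄₁⋯L_C̄_j h_{Ā₁…Ā_{r−1} Ā_r D})(0) = (L_C̄₁⋯L_C̄_j L_Ā_r h_{Ā₁…Ā_{r−1} D})(0)`;
in particular, if `ℓ₀ < ∞`, then
`h_{Ā₁ Ā₂ … Ā_{ℓ₀} D}(0) = (L_Ā_{ℓ₀} ⋯ L_Ā₂ h_{Ā₁ D})(0)`. -/
theorem statement6 (n : ℕ) (hn : 1 ≤ n) (Ω : Set (Fin (2 * n + 1) → ℝ))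
    (T : VF (2 * n + 1)) (L : Fin n → VF (2 * n + 1)) (θ : Form (2 * n + 1))
    (θup θbar : Fin n → Form (2 * n + 1))
    (hfr : CRFrame n Ω T L θ θup θbar)
    (ℓ₀ : ℕ∞)
    (hvan : ∀ (As : List (Fin n)) (D : Fin n), 1 ≤ As.length →
      (As.length : ℕ∞) < ℓ₀ → hD L θ As D 0 = 0)
    (hex : ∀ ℓ : ℕ, ℓ₀ = (ℓ : ℕ∞) →
      ∃ (As : List (Fin n)) (D : Fin n), As.length = ℓ ∧ hD L θ As D 0 ≠ 0)
    (hpos : 1 ≤ ℓ₀) :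
    (∀ (As : List (Fin n)) (Ar : Fin n) (Cs : List (Fin n)) (D : Fin n),
      1 ≤ As.length → ((Cs.length + As.length + 1 : ℕ) : ℕ∞) ≤ ℓ₀ →
      iterApp L Cs (hD L θ (As ++ [Ar]) D) 0 =
        iterApp L Cs (vapp (vconj (L Ar)) (hD L θ As D)) 0) ∧
    (∀ (A₁ : Fin n) (As : List (Fin n)) (D : Fin n),
      ℓ₀ = ((As.length + 1 : ℕ) : ℕ∞) →
      hD L θ (A₁ :: As) D 0 =
        (As.foldl (fun u A => vapp (vconj (L A)) u) (hD L θ [A₁] D)) 0) := by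
  have main : ∀ (As : List (Fin n)) (Ar : Fin n) (Cs : List (Fin n)) (D : Fin n),
      1 ≤ As.length → ((Cs.length + As.length + 1 : ℕ) : ℕ∞) ≤ ℓ₀ →
      iterApp L Cs (hD L θ (As ++ [Ar]) D) 0 =
        iterApp L Cs (vapp (vconj (L Ar)) (hD L θ As D)) 0 := by
    intro As A Cs D h1 h2
    have lt : ∀ j : ℕ, j ≤ Cs.length + As.length → (j : ℕ∞) < ℓ₀ := fun j hj =>
      lt_of_lt_of_le (by exact_mod_cast Nat.lt_succ_of_le hj) h2
    have e := iterApp_congr (L := L) hfr.open_Ω Cs (hD_err hfr As A D) hfr.mem0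
    rw [iterApp_add0 hfr Cs (Sm.vapp hfr.open_Ω (Sm.vconj (hfr.smoothL A)) (hD_smooth hfr As D))
        (err_smooth hfr As A D),
        err_van hfr As A D (hD_van hfr hvan Cs.length [A] D (by simp) (lt _ (by simp; omega)))
          (fun B => hD_van hfr hvan Cs.length As B h1 (lt _ (by omega))) Cs le_rfl,
        add_zero] at e
    exact e
  refine ⟨main, ?_⟩
  intro A₁ As D hℓ
  have gen : ∀ (Cs : List (Fin n)), ((Cs.length + As.length + 1 : ℕ) : ℕ∞) ≤ ℓ₀ →
      iterApp L Cs (hD L θ (A₁ :: As) D) 0 =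
      iterApp L Cs (As.foldl (fun u A => vapp (vconj (L A)) u) (hD L θ [A₁] D)) 0 := by
    clear hℓ
    induction As using List.reverseRecOn with
    | nil => intro Cs _; rfl
    | append_singleton As A ih =>
      intro Cs hC
      have e := main (A₁ :: As) A Cs D (by simp) (by
        refine le_trans (le_of_eq ?_) hC
        simp [add_assoc])
      rw [List.cons_append] at e
      rw [e, ← iterApp_snoc, ih (Cs ++ [A]) (by
        refine le_trans (le_of_eq ?_) hC
        simp [add_assoc, add_comm, add_left_comm]), iterApp_snoc]
      simp
  exact gen [] (by rw [hℓ]; simp)
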